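/- For each ray ρ ∈ σ(1), the vector Π_ρ := π₂^*(χ_ρ) is an extremal perfect matching of the quiver of sections Q. In addition, for every arrow a ∈ Q₁ one has a ∈ supp(Π_ρ) if and only if x_ρ divides the labelling monomial x^{div(a)}. -/

import Mathlib

namespace NCCell
/-- Toric data for a normal affine toric variety `X = Spec k[σ^∨ ∩ M]` of dimension `n`
with a torus-invariant point: the strongly convex, full-dimensional rational cone
`σ ⊆ ℝⁿ` is recorded through the primitive generators `v ρ` of its `d` extremal rays. -/
structure ToricData (n d : ℕ) where
  v : Fin d → Fin n → ℤ
  primitive : ∀ ρ, Finset.univ.gcd (fun i => (v ρ i).natAbs) = 1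
  strongly_convex : ∃ u : Fin n → ℤ, ∀ ρ, 0 < ∑ i, u i * v ρ i
  full_dim : ∀ u : Fin n → ℤ, (∀ ρ, ∑ i, u i * v ρ i = 0) → u = 0
  extremal_rays : ∀ ρ : Fin d, ∃ u : Fin n → ℤ,
    (∑ i, u i * v ρ i = 0) ∧ ∀ ρ', ρ' ≠ ρ → 0 < ∑ i, u i * v ρ' i

namespace ToricData
variable {n d : ℕ} (T : ToricData n d)
/-- The inclusion `M = ℤⁿ → ℤᵈ`, `u ↦ (⟨u, v_ρ⟩)_ρ`, from the exact sequence
`0 → M → ℤᵈ → Cl(X) → 0`. -/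
def iota : (Fin n → ℤ) →+ (Fin d → ℤ) where
  toFun u := fun ρ => ∑ i, u i * T.v ρ i
  map_zero' := by funext ρ; simp
  map_add' u w := by funext ρ; simp [add_mul, Finset.sum_add_distrib]
/-- The sublattice of `ℤᵈ` of principal torus-invariant Weil divisors, i.e. the image
of `M`; the class group `Cl(X)` is the quotient `ℤᵈ ⧸ prin`. -/
def prin : AddSubgroup (Fin d → ℤ) := T.iota.range
/-- `X` is Gorenstein: `(1,…,1)` lies in (the image of) `M`. -/
def Gorenstein : Prop := (fun _ => 1 : Fin d → ℤ) ∈ T.prin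
end ToricData

def toInt {d : ℕ} (u : Fin d → ℕ) : Fin d → ℤ := fun ρ => (u ρ : ℤ)

/-- A collection of distinct rank one reflexive sheaves on `X`, recorded through Weil
divisor representatives `D i` of their divisor classes. -/
structure Collection {n d : ℕ} (T : ToricData n d) (I : Type*) where
  D : I → Fin d → ℤ
  distinct : ∀ i j : I, D i - D j ∈ T.prin → i = j

namespace Collection
section
variable {n d : ℕ} {T : ToricData n d} {I : Type*} (C : Collection T I)
/-- `u ∈ ℕᵈ` is (the divisor of zeroes of) a torus-invariant section of
`Hom(E_i, E_j) = H⁰(X, O_X(D_j - D_i))`, i.e. `u` is effective of class `[D_j - D_i]`. -/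
def IsSection (i j : I) (u : Fin d → ℕ) : Prop :=
  toInt u - (C.D j - C.D i) ∈ T.prin
/-- A torus-invariant section is irreducible if it admits no nontrivial factorisation
through a member of the collection. -/
def IsIrreducible (i j : I) (u : Fin d → ℕ) : Prop :=
  C.IsSection i j u ∧
    ∀ (l : I) (u₁ u₂ : Fin d → ℕ), u = u₁ + u₂ →
      C.IsSection i l u₂ → C.IsSection l j u₁ →
      (l = i ∧ u₂ = 0) ∨ (l = j ∧ u₁ = 0)
/-- An arrow of the quiver of sections `Q` of the collection: an irreducible
torus-invariant section, with its head, tail and labelling divisor `div(a) ∈ ℕᵈ`. -/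
structure Arrow where
  src : I
  tgt : I
  lab : Fin d → ℕ
  irred : C.IsIrreducible src tgt lab
  nontriv : ¬ (src = tgt ∧ lab = 0)
/-- Paths in the quiver of sections (`nil i` is the trivial path `e_i`, and
`cons p a _` is the path `a·p`, i.e. `a` traversed last). -/
inductive Path : I → I → Type _
  | nil (i : I) : Path i i
  | cons {i j : I} (p : Path i j) (a : C.Arrow) (h : a.src = j) : Path i a.tgt
end

section
variable {n d : ℕ} {T : ToricData n d} {I : Type*} {C : Collection T I}
/-- The labelling divisor `div(p) ∈ ℕᵈ` of a path. -/
def Path.lab {i : I} : {j : I} → C.Path i j → (Fin d → ℕ)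
  | _, .nil _ => 0
  | _, .cons p a _ => Path.lab p + a.lab
/-- Composition of paths: `p.comp q` traverses `p` first, then `q`. -/
def Path.comp {i j : I} (p : C.Path i j) : {l : I} → C.Path j l → C.Path i l
  | _, .nil _ => p
  | _, .cons q a h => .cons (Path.comp p q) a h
/-- The arrow traversed last by a path. -/
def Path.lastArrow? {i : I} : {j : I} → C.Path i j → Option (C.Arrow)
  | _, .nil _ => none
  | _, .cons _ a _ => some a
/-- The arrow traversed first by a path. -/
def Path.firstArrow? {i : I} : {j : I} → C.Path i j → Option (C.Arrow)
  | _, .nil _ => none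
  | _, .cons p a _ => some ((Path.firstArrow? p).getD a)
/-- The list of arrows traversed by a path (last traversed first). -/
def Path.arrows {i : I} : {j : I} → C.Path i j → List (C.Arrow)
  | _, .nil _ => []
  | _, .cons p a _ => a :: Path.arrows p

/-- `pp - pm` is one of the generating relations of the ideal of superpotential
relations `J_W`: there is a path `q` such that the derivative `∂_q W` of the
superpotential `W = Σ_{p anticanonical cycle} p` is the sum of precisely the two paths
`pp` and `pm`, and these two paths share neither initial nor final arrow.  (Here
`∂_q W` is the sum of all paths `p` with tail at `h(q)`, head at `t(q)` and labelling
monomial `x^{div p} = Π_ρ x_ρ / x^{div q}`.) -/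
def IsSPRel {i j : I} (pp pm : C.Path i j) : Prop :=
  ∃ q : C.Path j i,
    (∀ ρ, pp.lab ρ + q.lab ρ = 1) ∧ (∀ ρ, pm.lab ρ + q.lab ρ = 1) ∧
    pp ≠ pm ∧
    pp.firstArrow? ≠ pm.firstArrow? ∧ pp.lastArrow? ≠ pm.lastArrow? ∧
    (∀ p : C.Path i j, (∀ ρ, p.lab ρ + q.lab ρ = 1) → p = pp ∨ p = pm)

/-- F-term equivalence of paths: the equivalence relation generated by
`q₂ p₊ q₁ ∼ q₂ p₋ q₁` for superpotential relations `p₊ - p₋ ∈ J_W`.  Two paths are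
identified in the superpotential algebra `A_W = kQ/J_W` iff they are F-term equivalent. -/
inductive FTermEquiv : {i j : I} → C.Path i j → C.Path i j → Prop
  | rel {i j l m : I} {pp pm : C.Path i j} (q₁ : C.Path l i) (q₂ : C.Path j m)
      (h : IsSPRel pp pm) :
      FTermEquiv ((q₁.comp pp).comp q₂) ((q₁.comp pm).comp q₂)
  | refl {i j : I} (p : C.Path i j) : FTermEquiv p p
  | symm {i j : I} {p q : C.Path i j} : FTermEquiv p q → FTermEquiv q p
  | trans {i j : I} {p q r : C.Path i j} : FTermEquiv p q → FTermEquiv q r → FTermEquiv p r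
end

/-- The toric algebra `A_𝓔 = kQ/J_𝓔` is consistent, i.e. `J_𝓔 = J_W`: since (classes of)
paths form bases of both quotient algebras, this says precisely that two paths of `Q`
with the same head and tail are identified in `A_𝓔` (i.e. share the same labelling
divisor) if and only if they are identified in `A_W` (i.e. are F-term equivalent). -/
def Consistent {n d : ℕ} {T : ToricData n d} {I : Type*} (C : Collection T I) : Prop :=
  ∀ (i j : I) (p q : C.Path i j), p.lab = q.lab ↔ FTermEquiv p q

end Collection
end NCCell

namespace NCCell
namespace Collection
section
variable {n d : ℕ} {T : ToricData n d} {I : Type*} [DecidableEq I] (C : Collection T I)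

/-- The value `π(χ_a) = (χ_{h(a)} - χ_{t(a)}, div a)` of the map
`π = (inc, div) : ℤ^{Q₁} → Wt(Q) ⊕ ℤᵈ` on the characteristic function of an arrow. -/
def piGen (a : C.Arrow) : (I → ℤ) × (Fin d → ℤ) :=
  (fun i => (if i = a.tgt then 1 else 0) - (if i = a.src then 1 else 0), toInt a.lab)

/-- The lattice `ℤ(Q) = π(ℤ^{Q₁})`, realised as the subgroup of `ℤ^{Q₀} ⊕ ℤᵈ`
generated by the vectors `π(χ_a)`. -/
def latZQ : AddSubgroup ((I → ℤ) × (Fin d → ℤ)) :=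
  AddSubgroup.closure (Set.range C.piGen)

/-- The semigroup `ℕ(Q) = π(ℕ^{Q₁})`, realised as the subsemigroup of `ℤ^{Q₀} ⊕ ℤᵈ`
generated by the vectors `π(χ_a)`. -/
def semiNQ : AddSubmonoid ((I → ℤ) × (Fin d → ℤ)) :=
  AddSubmonoid.closure (Set.range C.piGen)

end
end Collection
end NCCell

namespace NCCell
namespace Collection
variable {n d : ℕ} {T : ToricData n d} {I : Type*} [DecidableEq I] (C : Collection T I)

/-- The real vector `π(χ_a) ⊗ ℝ` in the ambient space `(ℝ^{Q₀} × ℝᵈ)` of `ℤ(Q) ⊗ ℝ`. -/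
def piGenR (a : C.Arrow) : (I → ℝ) × (Fin d → ℝ) :=
  (fun i => (if i = a.tgt then 1 else 0) - (if i = a.src then 1 else 0),
    fun ρ => (a.lab ρ : ℝ))

/-- The cone `C = {v ∈ ℤ(Q)^∨ ⊗ ℝ : ⟨u,v⟩ ≥ 0 for all u ∈ ℕ(Q)}`, whose elements are
represented by linear functionals on the ambient space `ℝ^{Q₀} × ℝᵈ` that are
nonnegative on the generators `π(χ_a)` of `ℕ(Q)` (every functional on `ℤ(Q) ⊗ ℝ`
extends to the ambient space, and two extensions represent the same element of `C`
iff they agree on the vectors `π(χ_a)`). -/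
def dualCone : Set (((I → ℝ) × (Fin d → ℝ)) →ₗ[ℝ] ℝ) :=
  {φ | ∀ a : C.Arrow, 0 ≤ φ (C.piGenR a)}

/-- The set of ambient functionals restricting on `ℤ(Q) ⊗ ℝ` to a nonnegative multiple
of the functional `Π_ρ = π₂^*(χ_ρ)`; this represents the ray `ℝ_{≥0}·Π_ρ` in
`ℤ(Q)^∨ ⊗ ℝ`.  (Note `Π_ρ (π(χ_a)) = ⟨χ_ρ, div a⟩ = div(a)_ρ`.) -/
def matchingRay (ρ : Fin d) : Set (((I → ℝ) × (Fin d → ℝ)) →ₗ[ℝ] ℝ) :=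
  {φ | ∃ c : ℝ, 0 ≤ c ∧ ∀ a : C.Arrow, φ (C.piGenR a) = c * (a.lab ρ : ℝ)}

end Collection
end NCCell

namespace NCCell

/-- Adding a large multiple of a vector `t` makes `w` effective, provided `w` vanishes wherever
`t` is not positive. -/
theorem exists_toInt_eq_add_nsmul {d : ℕ} (w t : Fin d → ℤ)
    (h : ∀ ρ, 0 < t ρ ∨ (w ρ = 0 ∧ t ρ = 0)) :
    ∃ (N : ℕ) (u : Fin d → ℕ), toInt u = w + N • t := by
  have key : ∀ ρ, 0 ≤ (w + (∑ ρ', (w ρ').natAbs) • t) ρ := by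
    intro ρ
    have hle : (w ρ).natAbs ≤ ∑ ρ', (w ρ').natAbs :=
      Finset.single_le_sum (f := fun ρ' => (w ρ').natAbs) (fun _ _ => Nat.zero_le _)
        (Finset.mem_univ ρ)
    rw [Pi.add_apply, Pi.smul_apply, nsmul_eq_mul]
    generalize (∑ ρ', (w ρ').natAbs) = N at hle
    rcases h ρ with ht | ⟨hw, ht⟩
    · have : (N : ℤ) ≤ N * t ρ := le_mul_of_one_le_right (by positivity) ht
      lia
    · simp [hw, ht]
  exact ⟨_, fun ρ => ((w + (∑ ρ', (w ρ').natAbs) • t) ρ).toNat,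
    funext fun ρ => Int.toNat_of_nonneg (key ρ)⟩

namespace ToricData
variable {n d : ℕ} (T : ToricData n d)

theorem iota_apply (m : Fin n → ℤ) (ρ : Fin d) : T.iota m ρ = ∑ i, m i * T.v ρ i := rfl

theorem iota_single (i : Fin n) (ρ : Fin d) : T.iota (Pi.single i 1) ρ = T.v ρ i := by
  simp [iota_apply, Pi.single_apply]

theorem iota_mem_prin (m : Fin n → ℤ) : T.iota m ∈ T.prin := ⟨m, rfl⟩

/-- A primitive ray generator pairs to `1` with some character. -/
theorem exists_iota_eq_one (ρ : Fin d) : ∃ m : Fin n → ℤ, T.iota m ρ = 1 := by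
  obtain ⟨g, hg⟩ := IsPrincipalIdealRing.principal (Ideal.span (Set.range (T.v ρ)))
  have hdvd : ∀ i, g ∣ T.v ρ i := by
    intro i
    rw [← Ideal.mem_span_singleton]
    have hi : T.v ρ i ∈ Ideal.span (Set.range (T.v ρ)) :=
      Ideal.subset_span (Set.mem_range_self i)
    rwa [hg] at hi
  have hunit : g.natAbs ∣ 1 := by
    rw [← T.primitive ρ]
    exact Finset.dvd_gcd fun i _ => Int.natAbs_dvd_natAbs.2 (hdvd i)
  have hone : (1 : ℤ) ∈ Ideal.span (Set.range (T.v ρ)) := by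
    rw [hg]
    exact Ideal.mem_span_singleton.2 (Int.natAbs_dvd_natAbs.1 hunit)
  exact Ideal.mem_span_range_iff_exists_fun.1 hone

/-- Every character is a difference of two characters of `σ^∨ ∩ M`. -/
theorem exists_toInt_sub_toInt (m : Fin n → ℤ) : ∃ u u' : Fin d → ℕ,
    toInt u ∈ T.prin ∧ toInt u' ∈ T.prin ∧ T.iota m = toInt u - toInt u' := by
  obtain ⟨p, hp⟩ := T.strongly_convex
  obtain ⟨N, u, hu⟩ := exists_toInt_eq_add_nsmul (T.iota m) (T.iota p) fun ρ => Or.inl (hp ρ)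
  have hu' : toInt (fun ρ => (N • T.iota p ρ).toNat) = N • T.iota p :=
    funext fun ρ => Int.toNat_of_nonneg (nsmul_nonneg (hp ρ).le N)
  have hmem : N • T.iota p ∈ T.prin := nsmul_mem (T.iota_mem_prin p) N
  exact ⟨u, _, hu ▸ add_mem (T.iota_mem_prin m) hmem, hu' ▸ hmem, by rw [hu, hu']; abel⟩

end ToricData

namespace Collection
variable {n d : ℕ} {T : ToricData n d} {I : Type*} {C : Collection T I}

theorem toInt_add (u w : Fin d → ℕ) : toInt (u + w) = toInt u + toInt w := by
  funext ρ
  simp [toInt]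

theorem isSection_self_iff (i : I) (u : Fin d → ℕ) : C.IsSection i i u ↔ toInt u ∈ T.prin := by
  simp [IsSection]

theorem IsSection.eq_of_zero {i j : I} (h : C.IsSection i j 0) : i = j := by
  apply C.distinct
  have h0 : toInt (0 : Fin d → ℕ) = 0 := by funext ρ; simp [toInt]
  simpa [IsSection, h0] using h

/-- Every torus-invariant section is a composite of arrows: a property of sections that holds
for identities and arrows and is stable under composition holds for all sections. -/
theorem IsSection.induction {P : I → I → (Fin d → ℕ) → Prop} (nil : ∀ i, P i i 0)
    (arrow : ∀ a : C.Arrow, P a.src a.tgt a.lab)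
    (comp : ∀ i l j u₁ u₂, P i l u₂ → P l j u₁ → P i j (u₁ + u₂))
    {i j : I} {u : Fin d → ℕ} (h : C.IsSection i j u) : P i j u := by
  induction hN : ∑ ρ, u ρ using Nat.strong_induction_on generalizing i j u with
  | _ N ih =>
    have sum_pos : ∀ w : Fin d → ℕ, w ≠ 0 → 0 < ∑ ρ, w ρ := by
      intro w hw
      obtain ⟨ρ, hρ⟩ := Function.ne_iff.1 hw
      exact Finset.sum_pos' (fun _ _ => Nat.zero_le _)
        ⟨ρ, Finset.mem_univ ρ, Nat.pos_of_ne_zero hρ⟩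
    by_cases htriv : i = j ∧ u = 0
    · obtain ⟨rfl, rfl⟩ := htriv
      exact nil i
    by_cases hirr : C.IsIrreducible i j u
    · exact arrow ⟨i, j, u, hirr, htriv⟩
    simp only [IsIrreducible, h, true_and] at hirr
    push Not at hirr
    obtain ⟨l, u₁, u₂, rfl, h₂, h₁, hne₂, hne₁⟩ := hirr
    have hu₂ : u₂ ≠ 0 := by
      rintro rfl
      exact hne₂ h₂.eq_of_zero.symm rfl
    have hu₁ : u₁ ≠ 0 := by
      rintro rfl
      exact hne₁ h₁.eq_of_zero rfl
    have hpos₁ := sum_pos u₁ hu₁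
    have hpos₂ := sum_pos u₂ hu₂
    simp only [Pi.add_apply, Finset.sum_add_distrib] at hN
    exact comp i l j u₁ u₂ (ih _ (by lia) h₂ rfl) (ih _ (by lia) h₁ rfl)

/-- The values `div(a)_ρ` on the arrows generate `ℤ`. -/
theorem closure_range_lab_eq_top [Nonempty I] (C : Collection T I) (ρ : Fin d) :
    AddSubgroup.closure (Set.range fun a : C.Arrow => (a.lab ρ : ℤ)) = ⊤ := by
  obtain ⟨i⟩ := ‹Nonempty I›
  set H := AddSubgroup.closure (Set.range fun a : C.Arrow => (a.lab ρ : ℤ))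
  have hsec : ∀ u : Fin d → ℕ, toInt u ∈ T.prin → toInt u ρ ∈ H := by
    intro u hu
    refine IsSection.induction (C := C) (P := fun _ _ u => toInt u ρ ∈ H) ?_ ?_ ?_
      ((isSection_self_iff i u).2 hu)
    · intro _
      simp [toInt, H.zero_mem]
    · exact fun a => AddSubgroup.subset_closure ⟨a, rfl⟩
    · intro _ _ _ u₁ u₂ h₂ h₁
      rw [toInt_add]
      exact H.add_mem h₁ h₂
  obtain ⟨m, hm⟩ := T.exists_iota_eq_one ρ
  obtain ⟨u, u', hu, hu', hsub⟩ := T.exists_toInt_sub_toInt m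
  have hone : (1 : ℤ) ∈ H := by
    rw [← hm, hsub]
    exact H.sub_mem (hsec u hu) (hsec u' hu')
  refine eq_top_iff.2 fun z _ => ?_
  simpa using H.zsmul_mem hone z

variable [DecidableEq I]

/-- The vector `(χ_j - χ_i, w)` of the ambient space of `ℤ(Q) ⊗ ℝ`. -/
def sectionVec (i j : I) (w : Fin d → ℤ) : (I → ℝ) × (Fin d → ℝ) :=
  (fun l => (if l = j then 1 else 0) - (if l = i then 1 else 0), fun ρ => (w ρ : ℝ))

theorem piGenR_eq_sectionVec (a : C.Arrow) :
    C.piGenR a = sectionVec a.src a.tgt (toInt a.lab) := by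
  simp [piGenR, sectionVec, toInt]

theorem sectionVec_self (i : I) (w : Fin d → ℤ) :
    sectionVec i i w = (0, fun ρ => (w ρ : ℝ)) := by
  ext <;> simp [sectionVec]

theorem sectionVec_self_zero (i : I) : sectionVec i i (toInt (0 : Fin d → ℕ)) = 0 := by
  ext <;> simp [sectionVec, toInt]

theorem sectionVec_add (i l j : I) (w w' : Fin d → ℤ) :
    sectionVec i j (w + w') = sectionVec i l w' + sectionVec l j w := by
  ext <;> simp [sectionVec, add_comm]

/-- A functional agreeing with `Π_ρ` on arrows agrees with it on all sections. -/
theorem IsSection.functional_eq {φ : ((I → ℝ) × (Fin d → ℝ)) →ₗ[ℝ] ℝ} {ρ : Fin d}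
    (hφ : ∀ a : C.Arrow, φ (C.piGenR a) = (a.lab ρ : ℝ))
    {i j : I} {u : Fin d → ℕ} (h : C.IsSection i j u) :
    φ (sectionVec i j (toInt u)) = u ρ := by
  refine h.induction (P := fun i j u => φ (sectionVec i j (toInt u)) = u ρ) ?_ ?_ ?_
  · intro i
    simp [sectionVec_self_zero]
  · intro a
    rw [← piGenR_eq_sectionVec, hφ]
  · intro i l j u₁ u₂ h₂ h₁
    rw [toInt_add, sectionVec_add i l j, map_add, h₂, h₁, Pi.add_apply, Nat.cast_add, add_comm]

theorem IsSection.functional_nonneg {φ : ((I → ℝ) × (Fin d → ℝ)) →ₗ[ℝ] ℝ}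
    (hφ : φ ∈ C.dualCone) {i j : I} {u : Fin d → ℕ} (h : C.IsSection i j u) :
    0 ≤ φ (sectionVec i j (toInt u)) := by
  refine h.induction (P := fun i j u => 0 ≤ φ (sectionVec i j (toInt u))) ?_ ?_ ?_
  · intro i
    simp [sectionVec_self_zero]
  · intro a
    rw [← piGenR_eq_sectionVec]
    exact hφ a
  · intro i l j u₁ u₂ h₂ h₁
    rw [toInt_add, sectionVec_add i l j, map_add]
    exact add_nonneg h₂ h₁

/-- A functional vanishing on the arrows whose label avoids `ρ` vanishes on all sections whose
divisor avoids `ρ`. -/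
theorem IsSection.functional_eq_zero {φ : ((I → ℝ) × (Fin d → ℝ)) →ₗ[ℝ] ℝ} {ρ : Fin d}
    (hφ : ∀ a : C.Arrow, a.lab ρ = 0 → φ (C.piGenR a) = 0)
    {i j : I} {u : Fin d → ℕ} (h : C.IsSection i j u) (hu : u ρ = 0) :
    φ (sectionVec i j (toInt u)) = 0 := by
  refine h.induction (P := fun i j u => u ρ = 0 → φ (sectionVec i j (toInt u)) = 0)
    ?_ ?_ ?_ hu
  · intro i _
    simp [sectionVec_self_zero]
  · intro a ha
    rw [← piGenR_eq_sectionVec, hφ a ha]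
  · intro i l j u₁ u₂ h₂ h₁ hsum
    obtain ⟨hu₁, hu₂⟩ := Nat.add_eq_zero_iff.1 hsum
    rw [toInt_add, sectionVec_add i l j, map_add, h₂ hu₂, h₁ hu₁, add_zero]

/-- A functional in the dual cone that vanishes on every arrow whose label avoids `ρ` lies on
the ray spanned by `Π_ρ`. -/
theorem mem_matchingRay_of_vanishing [Nonempty I] {φ : ((I → ℝ) × (Fin d → ℝ)) →ₗ[ℝ] ℝ}
    {ρ : Fin d} (hφ : φ ∈ C.dualCone)
    (hvan : ∀ a : C.Arrow, a.lab ρ = 0 → φ (C.piGenR a) = 0) : φ ∈ C.matchingRay ρ := by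
  obtain ⟨m, hm⟩ := T.exists_iota_eq_one ρ
  obtain ⟨f, hfρ, hf⟩ := T.extremal_rays ρ
  change T.iota f ρ = 0 at hfρ
  change ∀ ρ', ρ' ≠ ρ → 0 < T.iota f ρ' at hf
  let ψ : (Fin d → ℤ) →+ ℝ :=
    { toFun := fun w => φ (0, fun ρ' => (w ρ' : ℝ))
      map_zero' := by
        rw [← map_zero φ]
        congr 1
        ext <;> simp
      map_add' := fun w w' => by
        rw [← map_add]
        congr 1
        ext <;> simp }
  have hψ : ∀ i w, φ (sectionVec i i w) = ψ w := fun i w => by rw [sectionVec_self]; rfl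
  have hadd : ∀ i j w w', φ (sectionVec i j (w + w')) = φ (sectionVec i j w) + ψ w' := by
    intro i j w w'
    rw [sectionVec_add i i j, map_add, hψ, add_comm]
  have hψf : ψ (T.iota f) = 0 := by
    obtain ⟨i⟩ := ‹Nonempty I›
    have htoNat : toInt (fun ρ' => (T.iota f ρ').toNat) = T.iota f := by
      funext ρ'
      refine Int.toNat_of_nonneg ?_
      rcases eq_or_ne ρ' ρ with rfl | hne
      · exact hfρ.ge
      · exact (hf ρ' hne).le
    rw [← hψ i, ← htoNat]
    refine IsSection.functional_eq_zero hvan ((isSection_self_iff i _).2 ?_) (by simp [hfρ])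
    exact htoNat ▸ T.iota_mem_prin f
  refine ⟨ψ (T.iota m), ?_, ?_⟩
  · obtain ⟨i⟩ := ‹Nonempty I›
    obtain ⟨N, u, hu⟩ := exists_toInt_eq_add_nsmul (T.iota m - toInt (Pi.single ρ 1))
      (T.iota f) fun ρ' => by
        rcases eq_or_ne ρ' ρ with rfl | hne
        · exact Or.inr ⟨by simp [hm, toInt], hfρ⟩
        · exact Or.inl (hf ρ' hne)
    have hlift : toInt (u + Pi.single ρ 1) = T.iota m + N • T.iota f := by
      rw [toInt_add, hu]; abel
    have hsec : C.IsSection i i (u + Pi.single ρ 1) := by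
      rw [isSection_self_iff, hlift]
      exact add_mem (T.iota_mem_prin m) (nsmul_mem (T.iota_mem_prin f) N)
    have hnonneg := hsec.functional_nonneg hφ
    rwa [hψ, hlift, map_add, map_nsmul, hψf, smul_zero, add_zero] at hnonneg
  · intro a
    have hcond : ∀ ρ', 0 < T.iota f ρ' ∨
        ((toInt a.lab - a.lab ρ • T.iota m) ρ' = 0 ∧ T.iota f ρ' = 0) := by
      intro ρ'
      rcases eq_or_ne ρ' ρ with rfl | hne
      · exact Or.inr ⟨by simp [hm, toInt], hfρ⟩
      · exact Or.inl (hf ρ' hne)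
    obtain ⟨N, u, hu⟩ := exists_toInt_eq_add_nsmul _ _ hcond
    have huρ : u ρ = 0 := by
      have := congrFun hu ρ
      simpa [toInt, hm, hfρ] using this
    have hsec : C.IsSection a.src a.tgt u := by
      have heq : toInt u - (C.D a.tgt - C.D a.src) =
          (toInt a.lab - (C.D a.tgt - C.D a.src)) +
            (N • T.iota f - a.lab ρ • T.iota m) := by rw [hu]; abel
      unfold IsSection
      rw [heq]
      exact add_mem a.irred.1 (sub_mem (nsmul_mem (T.iota_mem_prin f) N)
        (nsmul_mem (T.iota_mem_prin m) _))
    have hlab : toInt a.lab = toInt u + (a.lab ρ • T.iota m - N • T.iota f) := by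
      rw [hu]; abel
    rw [piGenR_eq_sectionVec, hlab, hadd, hsec.functional_eq_zero hvan huρ, map_sub, map_nsmul,
      map_nsmul, hψf]
    simp [mul_comm]

theorem isExtreme_matchingRay [Nonempty I] (C : Collection T I) (ρ : Fin d) :
    IsExtreme ℝ C.dualCone (C.matchingRay ρ) := by
  refine ⟨?_, ?_⟩
  · rintro φ ⟨c, hc, hφ⟩ a
    rw [hφ]
    positivity
  · rintro φ hφ χ hχ _ ⟨c, _, hc⟩ ⟨s, t, hs, ht, _, rfl⟩
    refine mem_matchingRay_of_vanishing hφ fun a ha => ?_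
    have hsum : s * φ (C.piGenR a) + t * χ (C.piGenR a) = 0 := by
      simpa [ha] using hc a
    have hφa : 0 ≤ s * φ (C.piGenR a) := mul_nonneg hs.le (hφ a)
    have hχa : 0 ≤ t * χ (C.piGenR a) := mul_nonneg ht.le (hχ a)
    have hzero : s * φ (C.piGenR a) = 0 := by linarith
    exact (mul_eq_zero.1 hzero).resolve_left (ne_of_gt hs)

/-- A functional restricting to `Π_ρ` on `ℤ(Q) ⊗ ℝ` restricts to `v_ρ` on `M`. -/
theorem functional_iota_eq [Nonempty I] {φ : ((I → ℝ) × (Fin d → ℝ)) →ₗ[ℝ] ℝ} {ρ : Fin d}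
    (hφ : ∀ a : C.Arrow, φ (C.piGenR a) = (a.lab ρ : ℝ)) (m : Fin n → ℤ) :
    φ (0, fun ρ' => (T.iota m ρ' : ℝ)) = T.iota m ρ := by
  obtain ⟨i⟩ := ‹Nonempty I›
  obtain ⟨u, u', hu, hu', hsub⟩ := T.exists_toInt_sub_toInt m
  have hvec : ((0, fun ρ' => (T.iota m ρ' : ℝ)) : (I → ℝ) × (Fin d → ℝ)) =
      sectionVec i i (toInt u) - sectionVec i i (toInt u') := by
    ext <;> simp [sectionVec, hsub]
  rw [hvec, map_sub, IsSection.functional_eq hφ ((isSection_self_iff i u).2 hu),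
    IsSection.functional_eq hφ ((isSection_self_iff i u').2 hu'), hsub]
  simp [toInt]

end Collection
end NCCell

open NCCell Collection

/-- Proposition 2.12: for each ray `ρ ∈ σ(1)` the vector
`Π_ρ = π₂^*(χ_ρ)` is an extremal perfect matching of the quiver of sections `Q`, and an
arrow `a` lies in `supp(Π_ρ)` iff `x_ρ` divides `x^{div a}`.  Concretely:
(1) the ray `ℝ_{≥0}·Π_ρ` is a one-dimensional face (an extreme subset) of the cone `C`;
(2) `Π_ρ` is a primitive lattice point of `ℤ(Q)^∨`: its values `div(a)_ρ` on the
generators of `ℤ(Q)` generate all of `ℤ`;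
(3) `Π_ρ` is extremal: `ψ^*(Π_ρ) = v_ρ`, i.e. every ambient functional `φ` restricting
to `Π_ρ` on `ℤ(Q) ⊗ ℝ` satisfies `φ(ψ(e_i)) = v_ρ(i)`;
(4) `a ∈ supp(Π_ρ)` — that is, `⟨Π_ρ, π(χ_a)⟩ = div(a)_ρ > 0` — iff `x_ρ ∣ x^{div a}`. -/
theorem extremal_perfect_matching
    {n d : ℕ} (T : ToricData n d) {r : ℕ}
    (C : Collection T (Fin (r + 1))) (hD₀ : C.D 0 = 0) (ρ : Fin d) :
    IsExtreme ℝ (C.dualCone) (C.matchingRay ρ)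
    ∧ AddSubgroup.closure (Set.range fun a : C.Arrow => (a.lab ρ : ℤ)) = ⊤
    ∧ (∀ φ : ((Fin (r + 1) → ℝ) × (Fin d → ℝ)) →ₗ[ℝ] ℝ,
        (∀ a : C.Arrow, φ (C.piGenR a) = (a.lab ρ : ℝ)) →
        ∀ i, φ (0, fun ρ' => (T.v ρ' i : ℝ)) = T.v ρ i)
    ∧ (∀ a : C.Arrow, 0 < a.lab ρ ↔
        ∃ u : Fin d → ℕ, a.lab = u + fun ρ' => if ρ' = ρ then 1 else 0) := by
  refine ⟨C.isExtreme_matchingRay ρ, C.closure_range_lab_eq_top ρ, ?_, ?_⟩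
  · intro φ hφ i
    simpa only [T.iota_single] using functional_iota_eq hφ (Pi.single i 1)
  · intro a
    constructor
    · intro hpos
      refine ⟨fun ρ' => a.lab ρ' - if ρ' = ρ then 1 else 0, funext fun ρ' => ?_⟩
      by_cases h : ρ' = ρ
      · subst h
        simp only [Pi.add_apply, if_true]
        lia
      · simp [h]
    · rintro ⟨u, hu⟩
      simp [hu]
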